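/- Let k = m·2^n with m odd and n ≥ 0. There exists an ℓ ≥ 0 such that the clipped Thue–Morse morphism f_{ℓ,k} is cubefree if and only if m ≠ 3. -/

import Mathlib

/-- The Thue–Morse word: `tm n` is the parity of the number of 1s in the
binary representation of `n` (`true` = letter 1, `false` = letter 0). -/
def tm (n : ℕ) : Bool := ((Nat.digits 2 n).count 1) % 2 == 1

/-- The factor `t[ℓ..ℓ+k-1]` of the Thue–Morse word. -/
def tmFactor (ℓ k : ℕ) : List Bool := (List.range k).map (fun i => tm (ℓ + i))

/-- Complement of a binary word (exchange 0 and 1 in every position). -/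
def wcompl (w : List Bool) : List Bool := w.map (fun b => !b)

/-- Apply the binary morphism `0 ↦ h0, 1 ↦ h1` to the word `w`. -/
def applyMorph (h0 h1 : List Bool) (w : List Bool) : List Bool :=
  (w.map (fun b => bif b then h1 else h0)).flatten

/-- The Thue–Morse morphism μ : 0 ↦ 01, 1 ↦ 10. -/
def mu : List Bool → List Bool := applyMorph [false, true] [true, false]

/-- `p` is a period of the finite word `w`: `1 ≤ p ≤ |w|` and `w[i] = w[i+p]`
for all `i` with `i + p < |w|`. -/
def HasPeriodW (w : List Bool) (p : ℕ) : Prop :=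
  1 ≤ p ∧ p ≤ w.length ∧ ∀ i, i + p < w.length → w.getD i false = w.getD (i + p) false

/-- The smallest period of `w`. -/
noncomputable def per (w : List Bool) : ℕ := sInf {p | HasPeriodW w p}

/-- The exponent of `w`: `|w| / per(w)`. -/
noncomputable def wexp (w : List Bool) : ℝ := (w.length : ℝ) / (per w : ℝ)

/-- The critical exponent of `w`: supremum of exponents of nonempty factors of `w`. -/
noncomputable def ce (w : List Bool) : ℝ :=
  sSup {r : ℝ | ∃ x : List Bool, x ≠ [] ∧ x <:+: w ∧ r = wexp x}

/-- A `k`-prefix: the length-`k` prefix of the Thue–Morse word, or its complement. -/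
def kPrefix (k : ℕ) (s : List Bool) : Prop :=
  s = tmFactor 0 k ∨ s = wcompl (tmFactor 0 k)

/-- `v` is a finite factor of the Thue–Morse word. -/
def IsTMFactor (v : List Bool) : Prop := ∃ ℓ, v = tmFactor ℓ v.length

/-- The complementary morphism `0 ↦ h0, 1 ↦ complement of h0` is cubefree:
it maps every word of critical exponent `< 3` to a word of critical exponent `< 3`. -/
def CubefreeC (h0 : List Bool) : Prop :=
  ∀ w : List Bool, ce w < 3 → ce (applyMorph h0 (wcompl h0) w) < 3

/-- The word `x` occurs at position `i` of the word `w`. -/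
def OccursAt (x w : List Bool) (i : ℕ) : Prop :=
  i + x.length ≤ w.length ∧ (w.drop i).take x.length = x

/-- `u` has a cube of period `p` starting at position `A`. -/
def CubeAt (u : ℕ → Bool) (A p : ℕ) : Prop := ∀ i < 2 * p, u (A + i) = u (A + i + p)

/-- The first `n` letters of `u` contain no cube. -/
def NoCube (u : ℕ → Bool) (n : ℕ) : Prop :=
  ∀ A p, 0 < p → A + 3 * p ≤ n → ¬ CubeAt u A p

/-- The letters of the image of `w` under the complementary `k`-uniform morphism whose
image of `0` is `s 0, …, s (k - 1)`. -/
def morphLetter (s : ℕ → Bool) (k : ℕ) (w : ℕ → Bool) (i : ℕ) : Bool :=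
  xor (w (i / k)) (s (i % k))

/-- Cubefreeness of the complementary `k`-uniform morphism given by `s`, for words viewed as
functions. -/
def CubefreeMorph (s : ℕ → Bool) (k : ℕ) : Prop :=
  ∀ w n, NoCube w n → NoCube (morphLetter s k w) (k * n)

section Words

lemma wexp_lt_three_iff {x : List Bool} (hx : x ≠ []) :
    wexp x < 3 ↔ ∀ p, HasPeriodW x p → x.length < 3 * p := by
  have hlen : 0 < x.length := List.length_pos_iff.mpr hx
  have hne : {p | HasPeriodW x p}.Nonempty :=
    ⟨x.length, hlen, le_rfl, fun i hi => by omega⟩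
  have hper : HasPeriodW x (per x) := Nat.sInf_mem hne
  have hpos : (0 : ℝ) < per x := by exact_mod_cast hper.1
  rw [wexp, div_lt_iff₀ hpos]
  constructor
  · intro h p hp
    have h1 : per x ≤ p := Nat.sInf_le hp
    have h2 : x.length < 3 * per x := by exact_mod_cast h
    omega
  · intro h
    exact_mod_cast h _ hper

lemma ce_lt_three_iff_forall (w : List Bool) :
    ce w < 3 ↔ ∀ x, x ≠ [] → x <:+: w → wexp x < 3 := by
  set S : Set ℝ := {r : ℝ | ∃ x : List Bool, x ≠ [] ∧ x <:+: w ∧ r = wexp x} with hS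
  have hfin : S.Finite := by
    have h1 : {x : List Bool | x <:+: w}.Finite := by
      refine (w.sublists.toFinset.finite_toSet).subset ?_
      intro x hx
      simpa using hx.sublist
    refine (h1.image wexp).subset ?_
    rintro r ⟨x, -, hx, rfl⟩
    exact ⟨x, hx, rfl⟩
  change sSup S < 3 ↔ _
  constructor
  · intro h x hx hxw
    exact (le_csSup hfin.bddAbove ⟨x, hx, hxw, rfl⟩).trans_lt h
  · intro h
    rcases S.eq_empty_or_nonempty with h0 | h0
    · rw [h0, Real.sSup_empty]; norm_num
    · obtain ⟨x, hx, hxw, hr⟩ := h0.csSup_mem hfin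
      rw [hr]
      exact h x hx hxw

lemma ce_lt_three_iff (w : List Bool) :
    ce w < 3 ↔ NoCube (fun i => w.getD i false) w.length := by
  rw [ce_lt_three_iff_forall]
  constructor
  · intro h A p hp hA hc
    set x := (w.drop A).take (3 * p) with hx
    have hxl : x.length = 3 * p := by simp [hx]; omega
    have hxw : x <:+: w :=
      (List.take_prefix _ _).isInfix.trans (List.drop_suffix _ _).isInfix
    have hx0 : x ≠ [] := by
      intro h0
      rw [h0] at hxl
      simp at hxl
      omega
    have := (wexp_lt_three_iff hx0).1 (h x hx0 hxw) p ⟨hp, by omega, ?_⟩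
    · omega
    · intro i hi
      have h1 : ∀ j < 3 * p, x.getD j false = w.getD (A + j) false := by
        intro j hj
        simp [hx, List.getD_eq_getElem?_getD, hj]
      rw [h1 i (by omega), h1 (i + p) (by omega), ← Nat.add_assoc]
      exact hc i (by omega)
  · rintro h x hx ⟨a, b, rfl⟩
    rw [wexp_lt_three_iff hx]
    intro p hp
    by_contra! hlt
    refine h a.length p hp.1 (by simp; omega) ?_
    intro i hi
    have h1 : ∀ j < x.length, (a ++ x ++ b).getD (a.length + j) false = x.getD j false := by
      intro j hj
      simp [List.getD_eq_getElem?_getD, List.getElem?_append, hj]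
    simp only []
    rw [h1 i (by omega), Nat.add_assoc, h1 (i + p) (by omega)]
    exact hp.2.2 i (by omega)

lemma NoCube.congr {u v : ℕ → Bool} {n : ℕ} (h : NoCube u n) (huv : ∀ i < n, u i = v i) :
    NoCube v n := by
  intro A p hp hA hc
  refine h A p hp hA fun i hi => ?_
  rw [huv _ (by omega), huv _ (by omega)]
  exact hc i hi

lemma length_applyMorph (ℓ k : ℕ) (w : List Bool) :
    (applyMorph (tmFactor ℓ k) (wcompl (tmFactor ℓ k)) w).length = k * w.length := by
  induction w with
  | nil => simp [applyMorph]
  | cons b w ih =>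
    simp only [applyMorph, List.map_cons, List.flatten_cons, List.length_append,
      List.length_cons] at ih ⊢
    rw [ih]
    cases b <;> simp [tmFactor, wcompl] <;> ring

lemma getD_applyMorph (ℓ k : ℕ) (w : List Bool) (i : ℕ) (hi : i < k * w.length) :
    (applyMorph (tmFactor ℓ k) (wcompl (tmFactor ℓ k)) w).getD i false =
      morphLetter (fun j => tm (ℓ + j)) k (fun j => w.getD j false) i := by
  have hk : 0 < k := by
    rcases Nat.eq_zero_or_pos k with rfl | h
    · simp at hi
    · exact h
  induction w generalizing i with
  | nil => simp at hi
  | cons b w ih =>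
    have hb : (bif b then wcompl (tmFactor ℓ k) else tmFactor ℓ k).length = k := by
      cases b <;> simp [tmFactor, wcompl]
    have happ : applyMorph (tmFactor ℓ k) (wcompl (tmFactor ℓ k)) (b :: w) =
        (bif b then wcompl (tmFactor ℓ k) else tmFactor ℓ k) ++
          applyMorph (tmFactor ℓ k) (wcompl (tmFactor ℓ k)) w := by
      simp [applyMorph]
    rw [happ]
    by_cases hik : i < k
    · rw [List.getD_append _ _ _ _ (by omega)]
      cases b <;>
        simp [morphLetter, tmFactor, wcompl, Nat.div_eq_of_lt hik, Nat.mod_eq_of_lt hik,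
          List.getD_eq_getElem?_getD, hik]
    · push Not at hik
      rw [List.getD_append_right _ _ _ _ (by omega), hb,
        ih (i - k) (by simp only [List.length_cons] at hi; rw [Nat.mul_add] at hi; omega)]
      obtain ⟨j, rfl⟩ := Nat.exists_eq_add_of_le hik
      simp [morphLetter, Nat.add_div_left _ hk]

lemma cubefreeC_iff (ℓ k : ℕ) :
    CubefreeC (tmFactor ℓ k) ↔ CubefreeMorph (fun j => tm (ℓ + j)) k := by
  have key : ∀ w : List Bool, ce (applyMorph (tmFactor ℓ k) (wcompl (tmFactor ℓ k)) w) < 3 ↔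
      NoCube (morphLetter (fun j => tm (ℓ + j)) k (fun j => w.getD j false))
        (k * w.length) := by
    intro w
    rw [ce_lt_three_iff, length_applyMorph]
    exact ⟨fun h => h.congr fun i hi => getD_applyMorph ℓ k w i hi,
      fun h => h.congr fun i hi => (getD_applyMorph ℓ k w i hi).symm⟩
  constructor
  · intro h w n hw
    have hget : ∀ i < n, ((List.range n).map w).getD i false = w i := by
      intro i hi
      simp [List.getD_eq_getElem?_getD, hi]
    have h1 := (key ((List.range n).map w)).1 <| h _ <| (ce_lt_three_iff _).2 <| by
      simp only [List.length_map, List.length_range]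
      exact hw.congr fun i hi => (hget i hi).symm
    simp only [List.length_map, List.length_range] at h1
    refine h1.congr fun i hi => ?_
    rw [morphLetter, morphLetter, hget _ (Nat.div_lt_of_lt_mul hi)]
  · intro h w hw
    exact (key w).2 (h _ _ ((ce_lt_three_iff w).1 hw))

end Words

section ThueMorse

lemma tm_two_mul (n : ℕ) : tm (2 * n) = tm n := by
  rcases Nat.eq_zero_or_pos n with rfl | h
  · rfl
  · have := Nat.digits_add_two_add_one 0 (2 * n - 1)
    rw [show 2 * n - 1 + 1 = 2 * n by omega] at this
    simp only [tm]
    rw [this]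
    simp

lemma tm_two_mul_add_one (n : ℕ) : tm (2 * n + 1) = !tm n := by
  have := Nat.digits_add_two_add_one 0 (2 * n)
  simp only [tm]
  rw [this, show (2 * n + 1) % (0 + 2) = 1 by omega, show (2 * n + 1) / (0 + 2) = n by omega,
    List.count_cons_self]
  rcases Nat.mod_two_eq_zero_or_one (List.count 1 (Nat.digits 2 n)) with h | h
  · simp [h, show (List.count 1 (Nat.digits 2 n) + 1) % 2 = 1 by omega]
  · simp [h, show (List.count 1 (Nat.digits 2 n) + 1) % 2 = 0 by omega]

lemma tm_pow_mul_add (n q r : ℕ) (hr : r < 2 ^ n) :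
    tm (2 ^ n * q + r) = xor (tm q) (tm r) := by
  induction n generalizing r with
  | zero =>
    obtain rfl : r = 0 := by simpa using hr
    simp [show tm 0 = false from rfl]
  | succ n ih =>
    have hr2 : r / 2 < 2 ^ n := by rw [pow_succ] at hr; omega
    rcases Nat.even_or_odd' r with ⟨c, rfl | rfl⟩
    · rw [show 2 ^ (n + 1) * q + 2 * c = 2 * (2 ^ n * q + c) by ring, tm_two_mul, tm_two_mul,
        ih c (by omega)]
    · rw [show 2 ^ (n + 1) * q + (2 * c + 1) = 2 * (2 ^ n * q + c) + 1 by ring,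
        tm_two_mul_add_one, tm_two_mul_add_one, ih c (by omega)]
      simp

lemma tm_not_three_eq (n : ℕ) (h1 : tm n = tm (n + 1)) (h2 : tm (n + 1) = tm (n + 2)) :
    False := by
  rcases Nat.even_or_odd' n with ⟨c, rfl | rfl⟩
  · rw [tm_two_mul_add_one, tm_two_mul] at h1
    simp at h1
  · rw [show 2 * c + 1 + 1 = 2 * (c + 1) by ring, show 2 * c + 1 + 2 = 2 * (c + 1) + 1 by ring,
      tm_two_mul_add_one, tm_two_mul] at h2
    simp at h2

lemma tm_ne_succ_of_even {n : ℕ} (h : n % 2 = 0) : tm n ≠ tm (n + 1) := by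
  obtain ⟨c, rfl⟩ : ∃ c, n = 2 * c := ⟨n / 2, by omega⟩
  rw [tm_two_mul_add_one, tm_two_mul]
  simp

/-- Two equal or complementary windows of length five start at positions of the same parity. -/
lemma tm_window_parity {a b : ℕ} {c : Bool} (h : ∀ i < 5, tm (a + i) = xor c (tm (b + i))) :
    a % 2 = b % 2 := by
  by_contra hab
  wlog ha : a % 2 = 0 generalizing a b
  · refine this (a := b) (b := a) (fun i hi => ?_) (Ne.symm hab) (by omega)
    rw [h i hi]; simp
  obtain ⟨x, rfl⟩ : ∃ x, a = 2 * x := ⟨a / 2, by omega⟩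
  have e0 := h 0 (by omega)
  have e1 := h 1 (by omega)
  have e2 := h 2 (by omega)
  have e3 := h 3 (by omega)
  have e4 := h 4 (by omega)
  have n1 := tm_ne_succ_of_even (n := b + 1) (by omega)
  have n3 := tm_ne_succ_of_even (n := b + 3) (by omega)
  have t0 := tm_two_mul x
  have t1 := tm_two_mul_add_one x
  have t2 := tm_two_mul (x + 1)
  have t3 := tm_two_mul_add_one (x + 1)
  have t4 := tm_two_mul (x + 2)
  simp only [Nat.mul_add, Nat.mul_one, Nat.add_assoc, Nat.reduceMul, Nat.reduceAdd,
    Nat.add_zero] at e0 e1 e2 e3 e4 n1 n3 t0 t1 t2 t3 t4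
  have h3 := tm_not_three_eq x
  clear h hab ha
  cases tm x <;> cases tm (x + 1) <;> cases tm (x + 2) <;> cases c <;> simp_all

lemma tm_overlap_free (p A : ℕ) (hp : 0 < p) : ¬ ∀ i ≤ p, tm (A + i) = tm (A + i + p) := by
  induction p using Nat.strong_induction_on generalizing A with
  | _ p ih =>
  intro h
  rcases Nat.even_or_odd' p with ⟨q, rfl | rfl⟩
  · rcases Nat.even_or_odd' A with ⟨a, rfl | rfl⟩
    · refine ih q (by omega) a (by omega) fun i hi => ?_
      have := h (2 * i) (by omega)
      rwa [show 2 * a + 2 * i + 2 * q = 2 * (a + i + q) by ring,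
        show 2 * a + 2 * i = 2 * (a + i) by ring, tm_two_mul, tm_two_mul] at this
    · refine ih q (by omega) a (by omega) fun i hi => ?_
      have := h (2 * i) (by omega)
      rw [show 2 * a + 1 + 2 * i + 2 * q = 2 * (a + i + q) + 1 by ring,
        show 2 * a + 1 + 2 * i = 2 * (a + i) + 1 by ring, tm_two_mul_add_one,
        tm_two_mul_add_one] at this
      simpa using this
  · by_cases h4 : 2 ≤ q
    · have := tm_window_parity (a := A) (b := A + (2 * q + 1)) (c := false) fun i hi => by
        rw [h i (by omega)]
        simp only [Bool.false_xor]
        congr 1; omega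
      omega
    · obtain rfl | rfl : q = 0 ∨ q = 1 := by omega
      · exact tm_not_three_eq A (h 0 (by omega)) (h 1 (by omega))
      · have e0 := h 0 (by omega)
        have e1 := h 1 (by omega)
        have e2 := h 2 (by omega)
        have e3 := h 3 (by omega)
        rcases Nat.even_or_odd' A with ⟨a, rfl | rfl⟩
        · have t0 := tm_two_mul a
          have t1 := tm_two_mul_add_one a
          have t2 := tm_two_mul (a + 1)
          have t3 := tm_two_mul_add_one (a + 1)
          have t4 := tm_two_mul (a + 2)
          have t5 := tm_two_mul_add_one (a + 2)
          refine tm_not_three_eq a ?_ ?_ <;> grind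
        · have t1 := tm_two_mul_add_one a
          have t2 := tm_two_mul (a + 1)
          have t3 := tm_two_mul_add_one (a + 1)
          have t4 := tm_two_mul (a + 2)
          have t5 := tm_two_mul_add_one (a + 2)
          have t6 := tm_two_mul (a + 3)
          have t7 := tm_two_mul_add_one (a + 3)
          simp only [Nat.mul_add, Nat.mul_one, Nat.add_assoc, Nat.reduceMul, Nat.reduceAdd,
            Nat.add_zero] at e0 e1 e2 e3 t1 t2 t3 t4 t5 t6 t7
          clear h ih
          cases tm a <;> cases tm (a + 1) <;> cases tm (a + 2) <;> cases tm (a + 3) <;> simp_all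

/-- A factor with period or antiperiod `e` cannot be longer than four times `e`. -/
lemma tm_no_antiperiod {e A : ℕ} {c : Bool} (he : 0 < e) :
    ¬ ∀ i < 3 * e + 1, tm (A + i) = xor c (tm (A + i + e)) := by
  intro h
  refine tm_overlap_free (2 * e) A (by omega) fun i hi => ?_
  have h1 := h i (by omega)
  have h2 := h (i + e) (by omega)
  rw [h1, show A + i + e = A + (i + e) by ring, h2, show A + (i + e) + e = A + i + 2 * e by ring]
  cases c <;> simp

end ThueMorse

section Morphisms

lemma morphLetter_block (s w : ℕ → Bool) {k j : ℕ} (b : ℕ) (hj : j < k) :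
    morphLetter s k w (k * b + j) = xor (w b) (s j) := by
  rw [morphLetter, Nat.mul_add_div (by omega), Nat.div_eq_of_lt hj, Nat.mul_add_mod,
    Nat.mod_eq_of_lt hj, Nat.add_zero]

lemma not_cubeAt_of_dvd {s w : ℕ → Bool} {k n A p : ℕ} (hw : NoCube w n) (hk : 0 < k)
    (hp : 0 < p) (hA : A + 3 * p ≤ k * n) (hdvd : k ∣ p) :
    ¬ CubeAt (morphLetter s k w) A p := by
  obtain ⟨q, rfl⟩ := hdvd
  intro hc
  have hr := Nat.mod_lt A hk
  have hA' := Nat.div_add_mod A k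
  set a := A / k
  set r := A % k
  refine hw a q (Nat.pos_of_mul_pos_left hp) ?_ fun j hj => ?_
  · refine Nat.le_of_mul_le_mul_left ?_ hk
    calc k * (a + 3 * q) = k * a + 3 * (k * q) := by ring
      _ ≤ k * n := by omega
  · have h := hc (k * j) (by nlinarith)
    rw [← hA', show k * a + r + k * j = k * (a + j) + r by ring,
      show k * (a + j) + r + k * q = k * (a + j + q) + r by ring,
      morphLetter_block s w _ hr, morphLetter_block s w _ hr] at h
    simpa using h

lemma morphLetter_double_even (ℓ k : ℕ) (w : ℕ → Bool) (x : ℕ) :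
    morphLetter (fun j => tm (2 * ℓ + j)) (2 * k) w (2 * x) =
      morphLetter (fun j => tm (ℓ + j)) k w x := by
  simp only [morphLetter]
  rw [Nat.mul_div_mul_left _ _ (by norm_num), Nat.mul_mod_mul_left, ← Nat.mul_add, tm_two_mul]

lemma morphLetter_double_odd (ℓ k : ℕ) (w : ℕ → Bool) (x : ℕ) :
    morphLetter (fun j => tm (2 * ℓ + j)) (2 * k) w (2 * x + 1) =
      !morphLetter (fun j => tm (ℓ + j)) k w x := by
  simp only [morphLetter]
  have h1 : (2 * x + 1) / (2 * k) = x / k := by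
    rw [← Nat.div_div_eq_div_mul]; congr 1; omega
  have h2 : (2 * x + 1) % (2 * k) = 2 * (x % k) + 1 := by
    rw [Nat.mod_mul]
    have : (2 * x + 1) / 2 = x := by omega
    rw [this]; omega
  rw [h1, h2, ← Nat.add_assoc, ← Nat.mul_add, tm_two_mul_add_one, Bool.xor_not]

lemma cubefreeMorph_double_iff (ℓ k : ℕ) :
    CubefreeMorph (fun j => tm (2 * ℓ + j)) (2 * k) ↔
      CubefreeMorph (fun j => tm (ℓ + j)) k := by
  constructor
  · intro h w n hw A p hp hA hc
    refine h w n hw (2 * A) (2 * p) (by omega) (by rw [Nat.mul_assoc]; omega) fun i hi => ?_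
    rcases Nat.even_or_odd' i with ⟨x, rfl | rfl⟩
    · rw [← Nat.mul_add, ← Nat.mul_add, morphLetter_double_even, morphLetter_double_even]
      exact hc x (by omega)
    · rw [show 2 * A + (2 * x + 1) + 2 * p = 2 * (A + x + p) + 1 by ring,
        show 2 * A + (2 * x + 1) = 2 * (A + x) + 1 by ring, morphLetter_double_odd,
        morphLetter_double_odd, hc x (by omega)]
  · intro h w n hw A p hp hA hc
    set u := morphLetter (fun j => tm (2 * ℓ + j)) (2 * k) w with hu
    set v := morphLetter (fun j => tm (ℓ + j)) k w with hv
    have he : ∀ x, u (2 * x) = v x := morphLetter_double_even ℓ k w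
    have ho : ∀ x, u (2 * x + 1) = !v x := morphLetter_double_odd ℓ k w
    rcases Nat.even_or_odd' p with ⟨q, rfl | rfl⟩
    · refine h w n hw (A / 2) q (by omega) (by rw [Nat.mul_assoc] at hA; omega) fun i hi => ?_
      have h1 := hc (2 * i) (by omega)
      rcases Nat.even_or_odd' A with ⟨a, rfl | rfl⟩
      · rw [← Nat.mul_add, ← Nat.mul_add, he, he] at h1
        rwa [show 2 * a / 2 = a by omega]
      · rw [show 2 * a + 1 + 2 * i + 2 * q = 2 * (a + i + q) + 1 by ring,
          show 2 * a + 1 + 2 * i = 2 * (a + i) + 1 by ring, ho, ho] at h1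
        rw [show (2 * a + 1) / 2 = a by omega]
        simpa using h1
    · have hne : ∀ x, x % 2 = 0 → u (x + 1) = !u x := by
        intro x hx
        obtain ⟨y, rfl⟩ : ∃ y, x = 2 * y := ⟨x / 2, by omega⟩
        rw [ho, he]
      have halt : ∀ i, i + 1 < 2 * (2 * q + 1) → u (A + (i + 1)) = !u (A + i) := by
        intro i hi
        by_cases hpar : (A + i) % 2 = 0
        · exact hne _ hpar
        · rw [hc (i + 1) (by omega), hc i (by omega), ← hne _ (by omega)]
          congr 1; omega
      have hall : ∀ i, i < 2 * (2 * q + 1) → u (A + i) = xor (decide (i % 2 = 1)) (u A) := by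
        intro i
        induction i with
        | zero => simp
        | succ i ih =>
          intro hi
          rw [halt i hi, ih (by omega)]
          rcases Nat.mod_two_eq_zero_or_one i with h0 | h0
          · simp [h0, show (i + 1) % 2 = 1 by omega]
          · simp [h0, show (i + 1) % 2 = 0 by omega]
      have h1 := hc 0 (by omega)
      have h2 := hall (2 * q + 1) (by omega)
      rw [Nat.add_zero] at h1
      rw [← h1] at h2
      simp [show (2 * q + 1) % 2 = 1 by omega] at h2

/-- The word `s 0, …, s (k - 1)` and its complement occur only at multiples of `k` in images
under the complementary morphism it defines. -/
def Synchronized (s : ℕ → Bool) (k : ℕ) : Prop :=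
  ∀ d, 0 < d → d < k → ∀ c e : Bool, (∀ j < k - d, s j = xor c (s (j + d))) →
    (∀ j < d, s (k - d + j) = xor e (s j)) → False

lemma not_cubeAt_of_synchronized {s w : ℕ → Bool} {k A p : ℕ} (hs : Synchronized s k)
    (hk : 0 < k) (hp : k ≤ p) (hdvd : ¬ k ∣ p) : ¬ CubeAt (morphLetter s k w) A p := by
  intro hc
  have hd : p % k ≠ 0 := fun h => hdvd (Nat.dvd_of_mod_eq_zero h)
  have hlt := Nat.mod_lt p hk
  have hpk := Nat.div_add_mod p k
  have hb1 := Nat.div_add_mod (A + k - 1) k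
  have hb2 := Nat.mod_lt (A + k - 1) hk
  set d := p % k
  set q := p / k
  set b := (A + k - 1) / k
  have h : ∀ j < k, xor (w b) (s j) = morphLetter s k w (k * (b + q) + (j + d)) := by
    intro j hj
    have := hc (k * b + j - A) (by omega)
    rw [show A + (k * b + j - A) = k * b + j by omega, morphLetter_block s w b hj] at this
    rw [this, Nat.mul_add]
    congr 1; omega
  refine hs d (by omega) hlt (xor (w b) (w (b + q))) (xor (w b) (w (b + q + 1)))
    (fun j hj => ?_) fun j hj => ?_
  · have h1 := h j (by omega)
    rw [morphLetter_block s w _ (by omega)] at h1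
    rw [Bool.xor_assoc, ← h1]; simp
  · have h1 := h (k - d + j) (by omega)
    rw [show k * (b + q) + (k - d + j + d) = k * (b + q + 1) + j by
      rw [Nat.mul_succ]; omega, morphLetter_block s w _ (by omega)] at h1
    rw [Bool.xor_assoc, ← h1]; simp

lemma cubefreeMorph_of_synchronized {s : ℕ → Bool} {k : ℕ} (hk : 0 < k)
    (hs : Synchronized s k)
    (hshort : ∀ w n, NoCube w n → ∀ A p, 0 < p → p < k → A + 3 * p ≤ k * n →
      ¬ CubeAt (morphLetter s k w) A p) : CubefreeMorph s k := by
  intro w n hw A p hp hA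
  by_cases hdvd : k ∣ p
  · exact not_cubeAt_of_dvd hw hk hp hA hdvd
  · rcases Nat.lt_or_ge p k with hlt | hge
    · exact hshort w n hw A p hp hlt hA
    · exact not_cubeAt_of_synchronized hs hk hge hdvd

end Morphisms

section Negative

lemma noCube_of_not_three_eq {w : ℕ → Bool} {n : ℕ} (hn : n < 6)
    (h : ∀ A, A + 3 ≤ n → ¬ (w A = w (A + 1) ∧ w (A + 1) = w (A + 2))) : NoCube w n := by
  intro A p hp hA hc
  obtain rfl : p = 1 := by omega
  exact h A hA ⟨hc 0 (by omega), hc 1 (by omega)⟩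

lemma not_cubefreeMorph_of_ne {ℓ n : ℕ} (h : tm (ℓ / 2 ^ n) ≠ tm (ℓ / 2 ^ n + 3)) :
    ¬ CubefreeMorph (fun j => tm (ℓ + j)) (3 * 2 ^ n) := by
  intro hcf
  have hN : 0 < 2 ^ n := by positivity
  have hℓ := Nat.div_add_mod ℓ (2 ^ n)
  have hr := Nat.mod_lt ℓ hN
  have htm := tm_pow_mul_add n
  set q := ℓ / 2 ^ n
  set r := ℓ % 2 ^ n
  set N := 2 ^ n
  set w : ℕ → Bool := fun i => decide (i = 1) with hw
  have hno : NoCube w 3 := noCube_of_not_three_eq (by omega) fun A hA => by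
    obtain rfl : A = 0 := by omega
    simp [hw]
  set u := morphLetter (fun j => tm (ℓ + j)) (3 * N) w with hu
  let P : ℕ → Bool := fun x => if x < 3 then tm (q + 1 + x) else !tm (q + 1 + (x - 3))
  have hform : ∀ x y, x < 6 → y < N → u (N - r + (N * x + y)) = xor (P x) (tm y) := by
    intro x y hx hy
    have hcomm : 3 * N = N * 3 := by ring
    have hblock : ∀ β i z, i < 3 * N → N - r + (N * x + y) = 3 * N * β + i →
        ℓ + i = N * z + y → u (N - r + (N * x + y)) = xor (w β) (xor (tm z) (tm y)) := by
      intro β i z hi h1 h2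
      rw [h1, hu, morphLetter_block _ _ _ hi, h2, htm _ _ hy]
    have hflip : tm (q + 3) = !tm q := by
      revert h; cases tm q <;> cases tm (q + 3) <;> simp
    have hb0 : ∀ z, z = q + 1 + x → x < 3 → N - r + (N * x + y) < 3 * N →
        u (N - r + (N * x + y)) = xor (P x) (tm y) := by
      rintro z rfl hx3 hlt
      rw [hblock 0 _ (q + 1 + x) hlt (by simp) (by
        rw [Nat.mul_add, Nat.mul_add]; omega)]
      simp [hw, P, hx3]
    interval_cases x
    · exact hb0 _ rfl (by omega) (by omega)
    · exact hb0 _ rfl (by omega) (by omega)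
    · by_cases hlt : N - r + (N * 2 + y) < 3 * N
      · exact hb0 _ rfl (by omega) hlt
      · rw [hblock 1 (N - r + (N * 2 + y) - 3 * N) q (by omega) (by omega) (by omega)]
        simp [hw, P, hflip, Nat.add_assoc]
    · rw [hblock 1 (N - r + (N * 3 + y) - 3 * N) (q + 1) (by omega) (by omega)
        (by rw [Nat.mul_add]; omega)]
      simp [hw, P]
    · rw [hblock 1 (N - r + (N * 4 + y) - 3 * N) (q + 2) (by omega) (by omega)
        (by rw [Nat.mul_add]; omega)]
      simp [hw, P, Nat.add_assoc]
    · by_cases hlt : N - r + (N * 5 + y) < 6 * N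
      · rw [hblock 1 (N - r + (N * 5 + y) - 3 * N) (q + 3) (by omega) (by omega)
          (by rw [Nat.mul_add]; omega)]
        simp [hw, P, Nat.add_assoc]
      · rw [hblock 2 (N - r + (N * 5 + y) - 6 * N) q (by omega) (by omega) (by omega)]
        simp [hw, P, hflip, Nat.add_assoc]
  have hcube : ∀ x e, 0 < e → x + 3 * e ≤ 6 → (∀ j < 2 * e, P (x + j) = P (x + j + e)) →
      False := by
    intro x e he hxe hP
    refine hcf w 3 hno (N - r + N * x) (N * e) (by positivity) ?_ fun i hi => ?_
    · have : N * (x + 3 * e) ≤ N * 6 := Nat.mul_le_mul_left _ hxe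
      rw [Nat.mul_add] at this
      have h3 : N * (3 * e) = 3 * (N * e) := by ring
      have h4 : 3 * N * 3 = 9 * N := by ring
      omega
    · have hi' := Nat.div_add_mod i N
      have him := Nat.mod_lt i hN
      have hdiv : i / N < 2 * e := Nat.div_lt_of_lt_mul (by linarith)
      change u _ = u _
      rw [show N - r + N * x + i + N * e = N - r + (N * (x + i / N + e) + i % N) by
          rw [Nat.mul_add, Nat.mul_add]; omega,
        show N - r + N * x + i = N - r + (N * (x + i / N) + i % N) by
          rw [Nat.mul_add]; omega,
        hform _ _ (by omega) him, hform _ _ (by omega) him, hP _ hdiv]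
  have h0 := hcube 1 1 (by omega) (by omega)
  have h1 := hcube 2 1 (by omega) (by omega)
  have h2 := hcube 0 2 (by omega) (by omega)
  have hne := tm_not_three_eq (q + 1)
  simp only [P, Nat.forall_lt_succ_right, Nat.add_assoc] at h0 h1 h2 hne
  simp at h0 h1 h2 hne
  revert h0 h1 h2 hne
  cases tm (q + 1) <;> cases tm (q + 2) <;> cases tm (q + 3) <;> simp

lemma cubeAt_one {u : ℕ → Bool} {A : ℕ} (h1 : u A = u (A + 1)) (h2 : u (A + 1) = u (A + 2)) :
    CubeAt u A 1 := by
  intro i hi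
  obtain rfl | rfl : i = 0 ∨ i = 1 := by omega
  · exact h1
  · exact h2

lemma noCube_two (w : ℕ → Bool) : NoCube w 2 := fun A p hp hA => by omega

lemma tm_eq_of_pow {n x y : ℕ} (h : tm (x / 2 ^ n) = tm (y / 2 ^ n))
    (hmod : x % 2 ^ n = y % 2 ^ n) : tm x = tm y := by
  have hN : 0 < 2 ^ n := by positivity
  rw [← Nat.div_add_mod x (2 ^ n), ← Nat.div_add_mod y (2 ^ n),
    tm_pow_mul_add n _ _ (Nat.mod_lt _ hN), tm_pow_mul_add n _ _ (Nat.mod_lt _ hN), h, hmod]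

lemma not_cubefreeMorph_three (n ℓ : ℕ) :
    ¬ CubefreeMorph (fun j => tm (ℓ + j)) (3 * 2 ^ n) := by
  induction n generalizing ℓ with
  | zero =>
    intro hcf
    have h := hcf (fun i => decide (i = 1)) 2 (noCube_two _)
    have h0 := h 1 1 (by omega) (by omega)
    have h1 := h 2 1 (by omega) (by omega)
    have h2 := h 0 2 (by omega) (by omega)
    have hne := tm_not_three_eq ℓ
    simp only [CubeAt, Nat.forall_lt_succ_right, morphLetter] at h0 h1 h2 hne
    simp at h0 h1 h2 hne
    revert h0 h1 h2 hne
    cases tm ℓ <;> cases tm (ℓ + 1) <;> cases tm (ℓ + 2) <;> simp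
  | succ n ih =>
    rcases Nat.even_or_odd' ℓ with ⟨x, rfl | rfl⟩
    · rw [show 3 * 2 ^ (n + 1) = 2 * (3 * 2 ^ n) by ring, cubefreeMorph_double_iff]
      exact ih x
    · by_cases heq : tm ((2 * x + 1) / 2 ^ (n + 1)) = tm ((2 * x + 1) / 2 ^ (n + 1) + 3)
      swap
      · exact not_cubefreeMorph_of_ne heq
      intro hcf
      have hM : 0 < 2 ^ n := by positivity
      have hx := Nat.div_add_mod x (2 ^ n)
      have hq : (2 * x + 1) / 2 ^ (n + 1) = x / 2 ^ n := by
        rw [pow_succ', ← Nat.div_div_eq_div_mul]; congr 1; omega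
      rw [hq] at heq
      have hshift : ∀ y, y / 2 ^ n = x / 2 ^ n → tm (y + 3 * 2 ^ n) = tm y := by
        intro y hy
        refine tm_eq_of_pow (n := n) ?_ (by simp)
        rw [Nat.add_mul_div_right _ _ hM, hy, heq]
      rw [show 3 * 2 ^ (n + 1) = 6 * 2 ^ n by ring] at hcf
      set M := 2 ^ n
      have h := hcf (fun i => decide (i = 1)) 2 (noCube_two _)
      set u := morphLetter (fun j => tm (2 * x + 1 + j)) (6 * M) (fun i => decide (i = 1))
      have hl : ∀ j < 6 * M, u j = tm (2 * x + 1 + j) := by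
        intro j hj
        have := morphLetter_block (fun j => tm (2 * x + 1 + j)) (fun i => decide (i = 1)) 0 hj
        simpa using this
      have hr : ∀ j < 6 * M, u (6 * M + j) = !tm (2 * x + 1 + j) := by
        intro j hj
        have := morphLetter_block (fun j => tm (2 * x + 1 + j)) (fun i => decide (i = 1)) 1 hj
        simpa using this
      have u2 : u (6 * M - 2) = !tm (x + 3 * M - 1) := by
        rw [hl _ (by omega), ← tm_two_mul_add_one]; congr 1; omega
      have u1 : u (6 * M - 1) = tm x := by
        rw [hl _ (by omega), ← hshift x rfl, ← tm_two_mul (x + 3 * M)]; congr 1; omega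
      have u0 : u (6 * M) = tm x := by
        have := hr 0 (by omega)
        simpa [tm_two_mul_add_one] using this
      have u3 : u (6 * M + 1) = !tm (x + 1) := by
        rw [hr _ (by omega), ← tm_two_mul (x + 1)]; rfl
      have c1 := fun h1 h2 => h (6 * M - 2) 1 (by omega) (by omega) (cubeAt_one h1 h2)
      have c2 := fun h1 h2 => h (6 * M - 1) 1 (by omega) (by omega) (cubeAt_one h1 h2)
      rw [show 6 * M - 2 + 2 = 6 * M by omega, show 6 * M - 2 + 1 = 6 * M - 1 by omega,
        u2, u1, u0] at c1
      rw [show 6 * M - 1 + 2 = 6 * M + 1 by omega, show 6 * M - 1 + 1 = 6 * M by omega,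
        u3, u1, u0] at c2
      have e1 : tm (x + 3 * M - 1) = tm x := by
        revert c1; cases tm (x + 3 * M - 1) <;> cases tm x <;> simp
      have e2 : tm (x + 1) = tm x := by
        revert c2; cases tm (x + 1) <;> cases tm x <;> simp
      have e3 := hshift x rfl
      have hxm := Nat.mod_lt x hM
      by_cases hx0 : x % M = 0
      · refine tm_not_three_eq (x + 3 * M - 1) ?_ ?_
        · rw [e1, ← e3]; congr 1; omega
        · rw [show x + 3 * M - 1 + 1 = x + 3 * M by omega,
            show x + 3 * M - 1 + 2 = x + 1 + 3 * M by omega, e3]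
          by_cases hM1 : M = 1
          · exfalso
            rw [hM1] at e1 e3
            refine tm_not_three_eq x e2.symm ?_
            rw [e2, ← e1]; rfl
          · rw [hshift (x + 1), e2]
            refine Nat.div_eq_of_lt_le ?_ ?_
            · rw [Nat.mul_comm]; omega
            · rw [Nat.mul_comm, Nat.mul_succ]; omega
      · refine tm_not_three_eq (x - 1) ?_ ?_
        · rw [← hshift (x - 1), show x - 1 + 3 * M = x + 3 * M - 1 by omega, e1]
          · congr 1; omega
          · refine Nat.div_eq_of_lt_le ?_ ?_
            · rw [Nat.mul_comm]; omega
            · rw [Nat.mul_comm, Nat.mul_succ]; omega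
        · rw [show x - 1 + 1 = x by omega, show x - 1 + 2 = x + 1 by omega, e2]

end Negative

section SmallLength

/-- The number `N` if `w` is false, and otherwise the number whose `k` lowest binary digits
are the complements of those of `N`. -/
def blockDigits (N k : ℕ) (w : Bool) : ℕ := bif w then 2 ^ k - (N + 1) else N

/-- The number whose binary digits, from the lowest on, form the image of the four-letter word
`w₀w₁w₂w₃` if the `k` digits of `N` form the image of `0`. -/
def fourBlocks (N k : ℕ) (w₀ w₁ w₂ w₃ : Bool) : ℕ :=
  2 ^ k * (2 ^ k * (2 ^ k * blockDigits N k w₃ + blockDigits N k w₂) + blockDigits N k w₁) +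
    blockDigits N k w₀

/-- Every cube of period less than `k` that starts in the first block of the image of
`w₀w₁w₂w₃` comes from a cube of letters. -/
def ShortCubesLiftAt (N k : ℕ) (w₀ w₁ w₂ w₃ : Bool) : Prop :=
  ∀ a < k, ∀ p < k, p = 0 ∨
    (fourBlocks N k w₀ w₁ w₂ w₃ >>> a ^^^ fourBlocks N k w₀ w₁ w₂ w₃ >>> (a + p)) %
      2 ^ (2 * p) ≠ 0 ∨
    (w₀ = w₁ ∧ w₁ = w₂ ∧ 2 * k < a + 3 * p) ∨ (w₁ = w₂ ∧ w₂ = w₃ ∧ 3 * k < a + 3 * p)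

/-- The condition `ShortCubesLiftAt` for all four-letter words. -/
def ShortCubesLift (N k : ℕ) : Prop := ∀ w₀ w₁ w₂ w₃ : Bool, ShortCubesLiftAt N k w₀ w₁ w₂ w₃

instance (N k : ℕ) (w₀ w₁ w₂ w₃ : Bool) : Decidable (ShortCubesLiftAt N k w₀ w₁ w₂ w₃) :=
  inferInstanceAs (Decidable (∀ a < k, ∀ p < k, p = 0 ∨
    (fourBlocks N k w₀ w₁ w₂ w₃ >>> a ^^^ fourBlocks N k w₀ w₁ w₂ w₃ >>> (a + p)) %
      2 ^ (2 * p) ≠ 0 ∨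
    (w₀ = w₁ ∧ w₁ = w₂ ∧ 2 * k < a + 3 * p) ∨ (w₁ = w₂ ∧ w₂ = w₃ ∧ 3 * k < a + 3 * p)))

instance (N k : ℕ) : Decidable (ShortCubesLift N k) :=
  inferInstanceAs (Decidable (∀ w₀ w₁ w₂ w₃ : Bool, ShortCubesLiftAt N k w₀ w₁ w₂ w₃))

lemma blockDigits_lt {N k : ℕ} (hN : N < 2 ^ k) (w : Bool) : blockDigits N k w < 2 ^ k := by
  cases w
  · exact hN
  · exact Nat.sub_lt (by positivity) (by omega)

lemma testBit_blockDigits {N k j : ℕ} (hN : N < 2 ^ k) (hj : j < k) (w : Bool) :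
    (blockDigits N k w).testBit j = xor w (N.testBit j) := by
  cases w
  · simp [blockDigits]
  · simp [blockDigits, Nat.testBit_two_pow_sub_succ hN, hj]

lemma testBit_fourBlocks (w : ℕ → Bool) {N k b i : ℕ} (hN : N < 2 ^ k) (hi : i < 4 * k) :
    (fourBlocks N k (w b) (w (b + 1)) (w (b + 2)) (w (b + 3))).testBit i =
      morphLetter N.testBit k w (k * b + i) := by
  have hm : ∀ c j, j < k → i = c * k + j →
      morphLetter N.testBit k w (k * b + i) = (blockDigits N k (w (b + c))).testBit j := by
    rintro c j hj rfl
    rw [testBit_blockDigits hN hj, ← morphLetter_block _ w (b + c) hj]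
    congr 1
    ring
  have hlt := blockDigits_lt hN
  unfold fourBlocks
  rw [Nat.testBit_two_pow_mul_add _ (hlt _), Nat.testBit_two_pow_mul_add _ (hlt _),
    Nat.testBit_two_pow_mul_add _ (hlt _)]
  split_ifs
  · rw [hm 0 i (by omega) (by omega), Nat.add_zero]
  · rw [hm 1 (i - k) (by omega) (by omega)]
  · rw [hm 2 (i - k - k) (by omega) (by omega)]
  · rw [hm 3 (i - k - k - k) (by omega) (by omega)]

lemma xor_shiftRight_mod_eq_zero {V a p : ℕ} (h : CubeAt V.testBit a p) :
    (V >>> a ^^^ V >>> (a + p)) % 2 ^ (2 * p) = 0 := by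
  refine Nat.eq_of_testBit_eq fun i => ?_
  rw [Nat.testBit_mod_two_pow, Nat.testBit_xor, Nat.testBit_shiftRight, Nat.testBit_shiftRight,
    Nat.zero_testBit]
  by_cases hi : i < 2 * p
  · rw [h i hi, Nat.add_right_comm]
    simp
  · simp [hi]

lemma cubefreeMorph_of_shortCubesLift {N k : ℕ} (hk : 0 < k) (hN : N < 2 ^ k)
    (hs : Synchronized N.testBit k) (hc : ShortCubesLift N k) :
    CubefreeMorph N.testBit k := by
  refine cubefreeMorph_of_synchronized hk hs fun w n hw A p hp hpk hA hcube => ?_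
  have hr := Nat.mod_lt A hk
  have hA' := Nat.div_add_mod A k
  set b := A / k
  set r := A % k
  have hlt : ∀ c, c * k < r + 3 * p → b + c + 1 ≤ n := by
    intro c h
    have : k * (b + c) < k * n := by
      calc k * (b + c) = k * b + c * k := by ring
        _ < k * n := by omega
    exact Nat.lt_of_mul_lt_mul_left this
  rcases hc (w b) (w (b + 1)) (w (b + 2)) (w (b + 3)) r hr p hpk with
    h0 | h0 | ⟨h1, h2, h3⟩ | ⟨h1, h2, h3⟩
  · omega
  · refine h0 (xor_shiftRight_mod_eq_zero fun i hi => ?_)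
    rw [testBit_fourBlocks w hN (by omega), testBit_fourBlocks w hN (by omega), ← Nat.add_assoc,
      show k * b + (r + i + p) = A + i + p by omega, hA']
    exact hcube i hi
  · exact hw b 1 one_pos (hlt 2 h3) (cubeAt_one h1 h2)
  · exact hw (b + 1) 1 one_pos (hlt 3 h3) (cubeAt_one h1 h2)

instance (s : ℕ → Bool) (k : ℕ) : Decidable (Synchronized s k) :=
  decidable_of_iff (∀ d < k, 0 < d → ∀ c e : Bool, (∀ j < k - d, s j = xor c (s (j + d))) →
    (∀ j < d, s (k - d + j) = xor e (s j)) → False)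
    ⟨fun h d h0 h1 => h d h1 h0, fun h d h1 h0 => h d h0 h1⟩

lemma CubefreeMorph.congr {s s' : ℕ → Bool} {k : ℕ} (h : CubefreeMorph s k)
    (hs : ∀ j < k, s j = s' j) : CubefreeMorph s' k := by
  intro w n hw
  refine (h w n hw).congr fun i hi => ?_
  rw [morphLetter, morphLetter, hs _ (Nat.mod_lt _ (Nat.pos_of_ne_zero ?_))]
  rintro rfl
  omega

lemma exists_cubefreeMorph_small {k : ℕ} (hk : k < 23) (hodd : k % 2 = 1) (h5 : 5 ≤ k) :
    ∃ ℓ, CubefreeMorph (fun j => tm (ℓ + j)) k := by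
  have key : ∀ ℓ N : ℕ, N < 2 ^ k → (∀ j < k, N.testBit j = tm (ℓ + j)) →
      Synchronized N.testBit k → ShortCubesLift N k → ∃ ℓ, CubefreeMorph (fun j => tm (ℓ + j)) k :=
    fun ℓ N hlt hN hs hc => ⟨ℓ, (cubefreeMorph_of_shortCubesLift (by omega) hlt hs hc).congr hN⟩
  obtain rfl | rfl | rfl | rfl | rfl | rfl | rfl | rfl | rfl : k = 5 ∨ k = 7 ∨ k = 9 ∨ k = 11 ∨
      k = 13 ∨ k = 15 ∨ k = 17 ∨ k = 19 ∨ k = 21 := by omega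
  · exact key 0 22 (by norm_num) (by decide +kernel) (by decide +kernel) (by decide +kernel)
  · exact key 3 50 (by norm_num) (by decide +kernel) (by decide +kernel) (by decide +kernel)
  · exact key 3 306 (by norm_num) (by decide +kernel) (by decide +kernel) (by decide +kernel)
  · exact key 6 1446 (by norm_num) (by decide +kernel) (by decide +kernel) (by decide +kernel)
  · exact key 0 2454 (by norm_num) (by decide +kernel) (by decide +kernel) (by decide +kernel)
  · exact key 6 9638 (by norm_num) (by decide +kernel) (by decide +kernel) (by decide +kernel)
  · exact key 0 92566 (by norm_num) (by decide +kernel) (by decide +kernel) (by decide +kernel)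
  · exact key 15 208082 (by norm_num) (by decide +kernel) (by decide +kernel) (by decide +kernel)
  · exact key 0 616854 (by norm_num) (by decide +kernel) (by decide +kernel) (by decide +kernel)

end SmallLength

section LargeLength

lemma synchronized_tm {ℓ k : ℕ} (hodd : k % 2 = 1) (hk : 17 ≤ k) :
    Synchronized (fun j => tm (ℓ + j)) k := by
  intro d hd hdk c e h1 h2
  rcases Nat.mod_two_eq_zero_or_one d with hpar | hpar
  · by_cases h5 : 5 ≤ d
    · have := tm_window_parity (a := ℓ + (k - d)) (b := ℓ) (c := e) fun i hi => by
        rw [← h2 i (by omega), Nat.add_assoc]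
      omega
    · exact tm_no_antiperiod (A := ℓ) (c := c) hd fun i hi => by
        rw [Nat.add_assoc]
        exact h1 i (by omega)
  · by_cases h5 : 5 ≤ k - d
    · have := tm_window_parity (a := ℓ) (b := ℓ + d) (c := c) fun i hi => by
        rw [Nat.add_assoc, Nat.add_comm d]
        exact h1 i (by omega)
      omega
    · refine tm_no_antiperiod (e := k - d) (A := ℓ) (c := e) (by omega) fun i hi => ?_
      have : tm (ℓ + (k - d + i)) = xor e (tm (ℓ + i)) := h2 i (by omega)
      rw [Nat.add_assoc, Nat.add_comm i, this, ← Bool.xor_assoc, Bool.xor_self, Bool.false_xor]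

section Windows

variable {ℓ k b j p L : ℕ} {w : ℕ → Bool}

/-- A window and its translate by `p`, both inside one block, belong to a window and its
translate by `p` in the Thue–Morse word. -/
lemma tm_eq_of_same_block
    (h : ∀ i < L, morphLetter (fun j => tm (ℓ + j)) k w (k * b + j + i) =
      morphLetter (fun j => tm (ℓ + j)) k w (k * b + j + i + p)) (hL : j + L + p ≤ k) :
    ∀ i < L, tm (ℓ + j + i) = tm (ℓ + j + i + p) := by
  intro i hi
  have := h i hi
  rw [Nat.add_assoc, Nat.add_assoc _ (j + i), morphLetter_block _ w b (by omega),
    morphLetter_block _ w b (by omega), Bool.xor_right_inj] at this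
  simpa only [Nat.add_assoc] using this

lemma not_overlap_same_block (hp : 0 < p) (hL : j + (p + 1) + p ≤ k) :
    ¬ ∀ i < p + 1, morphLetter (fun j => tm (ℓ + j)) k w (k * b + j + i) =
      morphLetter (fun j => tm (ℓ + j)) k w (k * b + j + i + p) := fun h =>
  tm_overlap_free p (ℓ + j) hp fun i hi => tm_eq_of_same_block h hL i (by omega)

lemma not_odd_shift_same_block (hp : p % 2 = 1) (hL : j + 5 + p ≤ k) :
    ¬ ∀ i < 5, morphLetter (fun j => tm (ℓ + j)) k w (k * b + j + i) =
      morphLetter (fun j => tm (ℓ + j)) k w (k * b + j + i + p) := fun h => by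
  have := tm_window_parity (a := ℓ + j) (b := ℓ + j + p) (c := false) fun i hi => by
    rw [Bool.false_xor, tm_eq_of_same_block h hL i hi, Nat.add_right_comm]
  omega

/-- A window whose translate by `p` lies in the next block belongs, up to complement, to a
window and its translate by `k - p` in the Thue–Morse word. -/
lemma tm_eq_of_next_block
    (h : ∀ i < L, morphLetter (fun j => tm (ℓ + j)) k w (k * b + j + i) =
      morphLetter (fun j => tm (ℓ + j)) k w (k * b + j + i + p)) (hj : j + L ≤ k)
    (hjp : k ≤ j + p) (hL : j + p + L ≤ 2 * k) :
    ∀ i < L, tm (ℓ + (j + p - k) + i) = xor (xor (w b) (w (b + 1))) (tm (ℓ + j + i)) := by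
  intro i hi
  have := h i hi
  rw [show k * b + j + i + p = k * (b + 1) + (j + p - k + i) by rw [Nat.mul_add]; omega,
    Nat.add_assoc, morphLetter_block _ w b (by omega),
    morphLetter_block _ w (b + 1) (by omega)] at this
  simp only [Nat.add_assoc]
  revert this
  cases w b <;> cases w (b + 1) <;> simp +contextual

lemma not_even_shift_next_block (hk : k % 2 = 1) (hp : p % 2 = 0) (hj : j + 5 ≤ k)
    (hjp : k ≤ j + p) (hL : j + p + 5 ≤ 2 * k) :
    ¬ ∀ i < 5, morphLetter (fun j => tm (ℓ + j)) k w (k * b + j + i) =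
      morphLetter (fun j => tm (ℓ + j)) k w (k * b + j + i + p) := fun h => by
  have := tm_window_parity (tm_eq_of_next_block h hj hjp hL)
  omega

lemma not_short_shift_next_block (hpk : p < k) (hkp : k ≤ p + 4) (hj : j + 13 ≤ k)
    (hjp : k ≤ j + p) (hL : j + p + 13 ≤ 2 * k) :
    ¬ ∀ i < 13, morphLetter (fun j => tm (ℓ + j)) k w (k * b + j + i) =
      morphLetter (fun j => tm (ℓ + j)) k w (k * b + j + i + p) := fun h =>
  tm_no_antiperiod (e := k - p) (A := ℓ + (j + p - k)) (by omega) fun i hi => by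
    rw [tm_eq_of_next_block h hj hjp hL i (by omega),
      show ℓ + (j + p - k) + i + (k - p) = ℓ + j + i by omega]

end Windows

/-- The part of a window of the cube that starts at position `A + x`. -/
lemma CubeAt.window {u : ℕ → Bool} {A p x y L : ℕ} (h : CubeAt u A p) (hxy : A + x = y)
    (hL : x + L ≤ 2 * p) : ∀ i < L, u (y + i) = u (y + i + p) := by
  rintro i hi
  rw [← hxy, Nat.add_assoc A]
  exact h (x + i) (by omega)

lemma not_cubeAt_even {ℓ k b r p : ℕ} {w : ℕ → Bool} (hk : k % 2 = 1) (hr : r < k)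
    (hp : p % 2 = 0) (hp9 : 9 ≤ p) (hpk : p < k) :
    ¬ CubeAt (morphLetter (fun j => tm (ℓ + j)) k w) (k * b + r) p := by
  intro h
  have hb : k * (b + 1) = k * b + k := Nat.mul_succ k b
  by_cases hc : 5 ≤ k - r
  · by_cases hc' : 3 * p ≤ k - r + 4
    · exact not_overlap_same_block (by omega) (by omega)
        (h.window (x := 0) (y := k * b + r) rfl (by omega))
    · rcases le_total (k - r) p with hle | hle
      · exact not_even_shift_next_block hk hp (by omega) (by omega) (by omega)
          (h.window (x := 0) (y := k * b + r) rfl (by omega))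
      · exact not_even_shift_next_block hk hp (by omega) (by omega) (by omega)
          (h.window (x := k - r - p) (y := k * b + (k - p)) (by omega) (by omega))
  · by_cases hc' : 3 * p ≤ k - r + k + 4
    · exact not_overlap_same_block (b := b + 1) (j := 0) (by omega) (by omega)
        (h.window (x := k - r) (by omega) (by omega))
    · exact not_even_shift_next_block (b := b + 1) (j := k - p) hk hp (by omega) (by omega)
        (by omega) (h.window (x := k - r + (k - p)) (by omega) (by omega))

lemma not_cubeAt_odd {ℓ k b r p : ℕ} {w : ℕ → Bool} (hk : k % 2 = 1) (hk23 : 23 ≤ k)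
    (hr : r < k) (hp : p % 2 = 1) (hp9 : 9 ≤ p) (hpk : p < k) :
    ¬ CubeAt (morphLetter (fun j => tm (ℓ + j)) k w) (k * b + r) p := by
  intro h
  have hb : k * (b + 1) = k * b + k := Nat.mul_succ k b
  by_cases hc : p + 5 ≤ k - r
  · exact not_odd_shift_same_block hp (by omega)
      (h.window (x := 0) (y := k * b + r) rfl (by omega))
  by_cases hkp : p + 5 ≤ k
  · exact not_odd_shift_same_block (b := b + 1) (j := 0) hp (by omega)
      (h.window (x := k - r) (by omega) (by omega))
  by_cases hc13 : 13 ≤ k - r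
  · rcases le_total (k - r) p with hle | hle
    · exact not_short_shift_next_block hpk (by omega) (by omega) (by omega) (by omega)
        (h.window (x := 0) (y := k * b + r) rfl (by omega))
    · exact not_short_shift_next_block hpk (by omega) (by omega) (by omega) (by omega)
        (h.window (x := k - r - p) (y := k * b + (k - p)) (by omega) (by omega))
  · exact not_short_shift_next_block (b := b + 1) (j := k - p) hpk (by omega) (by omega)
      (by omega) (by omega) (h.window (x := k - r + (k - p)) (by omega) (by omega))

/-- The letter at position `x < 32` of `t[16q], t[16q+1], …`, up to complement, where `g` tells
whether `t[q]` and `t[q+1]` differ. -/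
def tmLocal (g : Bool) (x : ℕ) : Bool := bif x < 16 then tm x else xor g (tm (x - 16))

lemma tm_eq_tmLocal (q : ℕ) {x : ℕ} (hx : x < 32) :
    tm (16 * q + x) = xor (tm q) (tmLocal (xor (tm q) (tm (q + 1))) x) := by
  by_cases h : x < 16
  · rw [tmLocal, decide_eq_true h]
    exact tm_pow_mul_add 4 q x h
  · rw [tmLocal, decide_eq_false h, cond_false, ← Bool.xor_assoc, ← Bool.xor_assoc, Bool.xor_self,
      Bool.false_xor, ← tm_pow_mul_add 4 (q + 1) (x - 16) (by omega)]
    congr 1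
    omega

/-- The letters around the border of two blocks whose last 16 and first 16 letters are
described by `e, g` and `a, h`. -/
def borderLetter (e : ℕ) (g : Bool) (a : ℕ) (h c : Bool) (i : ℕ) : Bool :=
  bif i < 16 then tmLocal g (e + i) else xor c (tmLocal h (a + (i - 16)))

/-- There are no cubes of period at most 8 around the border of two blocks. -/
def BorderCubefree (e : ℕ) (g : Bool) (a : ℕ) (h : Bool) : Prop :=
  ∀ c : Bool, ∀ p < 9, ∀ A < 33, p = 0 ∨ 32 < A + 3 * p ∨
    ¬ ∀ i < 2 * p, borderLetter e g a h c (A + i) = borderLetter e g a h c (A + i + p)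

instance (e : ℕ) (g : Bool) (a : ℕ) (h : Bool) : Decidable (BorderCubefree e g a h) :=
  inferInstanceAs (Decidable (∀ c : Bool, ∀ p < 9, ∀ A < 33, p = 0 ∨ 32 < A + 3 * p ∨
    ¬ ∀ i < 2 * p, borderLetter e g a h c (A + i) = borderLetter e g a h c (A + i + p)))

lemma not_cubeAt_border {k b r p q Q a e : ℕ} {w : ℕ → Bool} (ha : a < 16) (he : e < 16)
    (hQ : 16 * q + a + k = 16 * Q + e + 16)
    (hloc : BorderCubefree e (xor (tm Q) (tm (Q + 1))) a (xor (tm q) (tm (q + 1))))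
    (hk : 16 ≤ k) (hp : 0 < p) (hp8 : p ≤ 8) (hr : r < k) (hr16 : k ≤ r + 16)
    (hrp : r + 3 * p ≤ k + 16) :
    ¬ CubeAt (morphLetter (fun j => tm (16 * q + a + j)) k w) (k * b + r) p := by
  intro hcube
  have hval : ∀ i < 3 * p, morphLetter (fun j => tm (16 * q + a + j)) k w (k * b + r + i) =
      xor (xor (w b) (tm Q)) (borderLetter e (xor (tm Q) (tm (Q + 1))) a
        (xor (tm q) (tm (q + 1))) (xor (xor (w b) (tm Q)) (xor (w (b + 1)) (tm q)))
        (r + 16 - k + i)) := by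
    intro i hi
    by_cases hlt : r + i < k
    · rw [Nat.add_assoc, morphLetter_block _ w b hlt, borderLetter,
        decide_eq_true (show r + 16 - k + i < 16 by omega), cond_true, Bool.xor_assoc,
        ← tm_eq_tmLocal Q (by omega)]
      congr 2
      omega
    · rw [show k * b + r + i = k * (b + 1) + (r + i - k) by rw [Nat.mul_add]; omega,
        morphLetter_block _ w (b + 1) (by omega), borderLetter,
        decide_eq_false (show ¬ r + 16 - k + i < 16 by omega), cond_false, ← Bool.xor_assoc,
        ← Bool.xor_assoc, Bool.xor_self, Bool.false_xor, Bool.xor_assoc,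
        ← tm_eq_tmLocal q (by omega), Nat.add_assoc]
      congr 4
      omega
  rcases hloc (xor (xor (w b) (tm Q)) (xor (w (b + 1)) (tm q))) p (by omega) (r + 16 - k)
    (by omega) with h0 | h0 | h0
  · omega
  · omega
  · refine h0 fun i hi => ?_
    have := hcube i hi
    rwa [Nat.add_assoc _ i, hval i (by omega), hval (i + p) (by omega), Bool.xor_right_inj,
      ← Nat.add_assoc] at this

lemma cubefreeMorph_of_borderCubefree {k q Q a e : ℕ} (hodd : k % 2 = 1) (hk : 23 ≤ k)
    (ha : a < 16) (he : e < 16) (hQ : 16 * q + a + k = 16 * Q + e + 16)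
    (hloc : BorderCubefree e (xor (tm Q) (tm (Q + 1))) a (xor (tm q) (tm (q + 1)))) :
    CubefreeMorph (fun j => tm (16 * q + a + j)) k := by
  refine cubefreeMorph_of_synchronized (by omega) (synchronized_tm hodd (by omega))
    fun w n _ A p hp hpk _ => ?_
  rw [← Nat.div_add_mod A k]
  have hr := Nat.mod_lt A (show 0 < k by omega)
  generalize A / k = b at *
  generalize A % k = r at *
  have hb : k * (b + 1) = k * b + k := Nat.mul_succ k b
  by_cases hp9 : 9 ≤ p
  · rcases Nat.mod_two_eq_zero_or_one p with hpar | hpar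
    · exact not_cubeAt_even hodd hr hpar hp9 hpk
    · exact not_cubeAt_odd hodd hk hr hpar hp9 hpk
  by_cases h1 : 2 * p + 1 ≤ k - r
  · exact fun h => not_overlap_same_block hp (by omega)
      (h.window (x := 0) (y := k * b + r) rfl (by omega))
  by_cases h2 : k - r < p
  · exact fun h => not_overlap_same_block (b := b + 1) (j := 0) hp (by omega)
      (h.window (x := k - r) (by omega) (by omega))
  exact not_cubeAt_border ha he hQ hloc (by omega) hp (by omega) hr (by omega) (by omega)

lemma tm_two_mul_ne (x : ℕ) : tm (2 * x) ≠ tm (2 * x + 1) := tm_ne_succ_of_even (by omega)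

/-- At every positive distance `K` from some square of letters in the Thue–Morse word there is a
factor of two distinct letters, and vice versa. -/
lemma exists_tm_eq_ne {K : ℕ} (hK : 0 < K) :
    (∃ q, tm q = tm (q + 1) ∧ tm (q + K) ≠ tm (q + K + 1)) ∧
      ∃ q, tm q ≠ tm (q + 1) ∧ tm (q + K) = tm (q + K + 1) := by
  induction K using Nat.strong_induction_on with
  | _ K ih =>
  have hodd : ∀ x, tm (2 * x + 1) = tm (2 * x + 1 + 1) ↔ tm x ≠ tm (x + 1) := by
    intro x
    rw [show 2 * x + 1 + 1 = 2 * (x + 1) by ring, tm_two_mul_add_one, tm_two_mul]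
    cases tm x <;> cases tm (x + 1) <;> simp
  rcases Nat.even_or_odd' K with ⟨x, rfl | rfl⟩
  · obtain ⟨⟨q, h1, h2⟩, ⟨q', h3, h4⟩⟩ := ih x (by omega) (by omega)
    refine ⟨⟨2 * q' + 1, (hodd q').2 h3, ?_⟩, ⟨2 * q + 1, fun h => (hodd q).1 h h1, ?_⟩⟩
    · rw [show 2 * q' + 1 + 2 * x = 2 * (q' + x) + 1 by ring]
      exact fun h => (hodd _).1 h h4
    · rw [show 2 * q + 1 + 2 * x = 2 * (q + x) + 1 by ring]
      exact (hodd _).2 h2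
  · refine ⟨⟨1, by decide, tm_ne_succ_of_even (by omega)⟩, ?_⟩
    rcases Nat.even_or_odd' x with ⟨y, rfl | rfl⟩
    · refine ⟨0, by decide, ?_⟩
      rw [Nat.zero_add]
      exact (hodd _).2 (tm_two_mul_ne y)
    · refine ⟨2, by decide, ?_⟩
      rw [show 2 + (2 * (2 * y + 1) + 1) = 2 * (2 * (y + 1)) + 1 by ring]
      exact (hodd _).2 (tm_two_mul_ne _)

lemma exists_cubefreeMorph_large {k : ℕ} (hodd : k % 2 = 1) (hk : 23 ≤ k) :
    ∃ ℓ, CubefreeMorph (fun j => tm (ℓ + j)) k := by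
  have key : ∀ a e Q, a < 16 → e < 16 → a + k = 16 * Q + e + 16 →
      (∀ g, BorderCubefree e g a true) → ∃ ℓ, CubefreeMorph (fun j => tm (ℓ + j)) k :=
    fun a e Q ha he hQ hloc =>
      ⟨_, cubefreeMorph_of_borderCubefree (q := 0) (Q := Q) hodd hk ha he (by omega) (hloc _)⟩
  have hdiv := Nat.div_add_mod k 16
  have hmod : k % 16 = 1 ∨ k % 16 = 3 ∨ k % 16 = 5 ∨ k % 16 = 7 ∨ k % 16 = 9 ∨ k % 16 = 11 ∨
      k % 16 = 13 ∨ k % 16 = 15 := by omega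
  rcases hmod with h | h | h | h | h | h | h | h
  · exact key 3 4 (k / 16 - 1) (by omega) (by omega) (by omega) (by decide +kernel)
  · obtain ⟨q, h1, h2⟩ := (exists_tm_eq_ne (K := k / 16) (by omega)).1
    refine ⟨16 * q + 14, cubefreeMorph_of_borderCubefree (Q := q + k / 16) (e := 1) hodd hk
      (by omega) (by omega) (by omega) ?_⟩
    rw [h1, Bool.xor_self, Bool.eq_not_of_ne h2, Bool.not_xor, Bool.xor_self]
    decide +kernel
  · exact key 0 5 (k / 16 - 1) (by omega) (by omega) (by omega) (by decide +kernel)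
  · exact key 3 10 (k / 16 - 1) (by omega) (by omega) (by omega) (by decide +kernel)
  · exact key 3 12 (k / 16 - 1) (by omega) (by omega) (by omega) (by decide +kernel)
  · exact key 15 10 (k / 16) (by omega) (by omega) (by omega) (by decide +kernel)
  · exact key 0 13 (k / 16 - 1) (by omega) (by omega) (by omega) (by decide +kernel)
  · exact key 6 5 (k / 16) (by omega) (by omega) (by omega) (by decide +kernel)

end LargeLength

lemma cubefreeMorph_one (s : ℕ → Bool) : CubefreeMorph s 1 := fun _ _ hw _ _ hp hA =>
  not_cubeAt_of_dvd hw one_pos hp hA (one_dvd _)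

lemma exists_cubefreeMorph {m : ℕ} (hm : m % 2 = 1) (h3 : m ≠ 3) (n : ℕ) :
    ∃ ℓ, CubefreeMorph (fun j => tm (ℓ + j)) (m * 2 ^ n) := by
  induction n with
  | zero =>
    rw [pow_zero, Nat.mul_one]
    obtain rfl | ⟨h5, h23⟩ | h23 : m = 1 ∨ 5 ≤ m ∧ m < 23 ∨ 23 ≤ m := by omega
    · exact ⟨0, cubefreeMorph_one _⟩
    · exact exists_cubefreeMorph_small h23 hm h5
    · exact exists_cubefreeMorph_large hm h23
  | succ n ih =>
    obtain ⟨ℓ, h⟩ := ih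
    refine ⟨2 * ℓ, ?_⟩
    rw [pow_succ', Nat.mul_left_comm]
    exact (cubefreeMorph_double_iff ℓ _).2 h

/-- for `k = m·2ⁿ` with `m` odd, a cubefree clipped Thue–Morse
morphism `f_{ℓ,k}` exists if and only if `m ≠ 3`. -/
theorem stmt9 (m n k : ℕ) (hm : Odd m) (hk : k = m * 2 ^ n) :
    (∃ ℓ : ℕ, CubefreeC (tmFactor ℓ k)) ↔ m ≠ 3 := by
  subst hk
  simp only [cubefreeC_iff]
  refine ⟨?_, fun h3 => exists_cubefreeMorph (Nat.odd_iff.1 hm) h3 n⟩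
  rintro ⟨ℓ, h⟩ rfl
  exact not_cubefreeMorph_three n ℓ h
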